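/- Let X_1,...,X_d (d ≥ 2) and Y be discrete random variables with values in finite sets, jointly distributed with strictly positive pmf P, and let μ : {2,...,d} → {1,...,d} be a mother function (μ(i) < i for all i, μ(2) = 1). Then Σ_{i=2}^d I(Y, X_{μ(i)}, X_i) − Σ_{i=3}^d I(Y, X_{μ(i)}) ≤ Σ_{i=1}^d H(X_i) + H(Y) − H(X_1,...,X_d,Y); i.e. the weight of any Generalized Naive Bayes approximation never exceeds the total correlation of the joint distribution. -/

import Mathlib

open scoped Classical BigOperators
open Real

noncomputable section

namespace GNB

variable {d : ℕ} {α : Fin d → Type} {β : Type} [∀ i, Fintype (α i)] [Fintype β]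

/-- A joint configuration of the explanatory variables `X i` and the class variable `Y`. -/
abbrev Cfg (α : Fin d → Type) (β : Type) := ((i : Fin d) → α i) × β

/-- Marginal pmf of the class variable `Y`. -/
def margY (P : Cfg α β → ℝ) (y : β) : ℝ := ∑ x : (i : Fin d) → α i, P (x, y)

/-- Marginal pmf of the variable `X i`. -/
def margX (P : Cfg α β → ℝ) (i : Fin d) (a : α i) : ℝ :=
  ∑ z : Cfg α β, if z.1 i = a then P z else 0

/-- Marginal pmf of the pair `(X i, Y)`. -/
def margXY (P : Cfg α β → ℝ) (i : Fin d) (a : α i) (y : β) : ℝ :=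
  ∑ x : (i : Fin d) → α i, if x i = a then P (x, y) else 0

/-- Marginal pmf of the triplet `(X i, X j, Y)`. -/
def margXXY (P : Cfg α β → ℝ) (i j : Fin d) (a : α i) (b : α j) (y : β) : ℝ :=
  ∑ x : (i : Fin d) → α i, if x i = a ∧ x j = b then P (x, y) else 0

/-- Joint entropy `H(X_1,…,X_d,Y)`. -/
def HJoint (P : Cfg α β → ℝ) : ℝ := -∑ z : Cfg α β, P z * Real.log (P z)

/-- Entropy `H(Y)`. -/
def HY (P : Cfg α β → ℝ) : ℝ := -∑ y : β, margY P y * Real.log (margY P y)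

/-- Entropy `H(X i)`. -/
def HX (P : Cfg α β → ℝ) (i : Fin d) : ℝ :=
  -∑ a : α i, margX P i a * Real.log (margX P i a)

/-- Entropy `H(Y, X i)`. -/
def HYX (P : Cfg α β → ℝ) (i : Fin d) : ℝ :=
  -∑ y : β, ∑ a : α i, margXY P i a y * Real.log (margXY P i a y)

/-- Entropy `H(Y, X i, X j)`. -/
def HYXX (P : Cfg α β → ℝ) (i j : Fin d) : ℝ :=
  -∑ y : β, ∑ a : α i, ∑ b : α j, margXXY P i j a b y * Real.log (margXXY P i j a b y)

/-- Mutual information `I(X i ; Y)`. -/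
def IY2 (P : Cfg α β → ℝ) (i : Fin d) : ℝ :=
  ∑ y : β, ∑ a : α i, margXY P i a y *
    Real.log (margXY P i a y / (margX P i a * margY P y))

/-- Information content `I(Y, X i, X j)`. -/
def IY3 (P : Cfg α β → ℝ) (i j : Fin d) : ℝ :=
  ∑ y : β, ∑ a : α i, ∑ b : α j, margXXY P i j a b y *
    Real.log (margXXY P i j a b y / (margY P y * margX P i a * margX P j b))

/-- Kullback–Leibler divergence `KL(p ‖ q)`. -/
def KL {γ : Type} [Fintype γ] (p q : γ → ℝ) : ℝ := ∑ c : γ, p c * Real.log (p c / q c)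

/-- The Naive Bayes approximation `P_NB(x,y) = P(y) ∏ i, P(x i | y)`. -/
def PNB (P : Cfg α β → ℝ) : Cfg α β → ℝ :=
  fun z => margY P z.2 * ∏ i : Fin d, (margXY P i (z.1 i) z.2 / margY P z.2)

/-- The Generalized Naive Bayes approximation determined by the mother function `μ`:
`P_GNB(x,y) = (∏_{i=2}^d P(y, x_{μ i}, x_i)) / (∏_{i=3}^d P(y, x_{μ i}))`
(indices are `0`-based: variable `X_k` of the paper is `X (k-1)` here). -/
def PGNB (P : Cfg α β → ℝ) (μ : Fin d → Fin d) : Cfg α β → ℝ :=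
  fun z =>
    (∏ i ∈ Finset.univ.filter (fun i : Fin d => 1 ≤ (i : ℕ)),
        margXXY P (μ i) i (z.1 (μ i)) (z.1 i) z.2) /
    (∏ i ∈ Finset.univ.filter (fun i : Fin d => 2 ≤ (i : ℕ)),
        margXY P (μ i) (z.1 (μ i)) z.2)

/-- Predecessor on `Fin d` (truncated at `0`). -/
def pred (i : Fin d) : Fin d := ⟨(i : ℕ) - 1, lt_of_le_of_lt (Nat.sub_le _ _) i.isLt⟩

end GNB

namespace GNB

section Marginals

variable {d : ℕ} {α : Fin d → Type} {β : Type} [∀ i, Fintype (α i)]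

/-- The total mass of a product of kernels, each depending only on the earlier coordinates, is
one. -/
lemma sum_prod_kernel_eq_one {n : ℕ} {α : Fin n → Type} [∀ i, Fintype (α i)]
    [∀ i, Nonempty (α i)] (k : ∀ i : Fin n, (∀ j, α j) → α i → ℝ)
    (hdep : ∀ i x x', (∀ j < i, x j = x' j) → k i x = k i x')
    (hsum : ∀ i x, ∑ b, k i x b = 1) :
    ∑ x : (∀ i, α i), ∏ i, k i x (x i) = 1 := by
  induction n with
  | zero => simp
  | succ n ih =>
    let b₀ : α (Fin.last n) := Classical.arbitrary _
    have hcast (x : ∀ i : Fin n, α i.castSucc) (b : α (Fin.last n)) (i : Fin n) :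
        k i.castSucc (Fin.snoc x b) = k i.castSucc (Fin.snoc x b₀) := by
      refine hdep _ _ _ fun j hj => ?_
      obtain ⟨j, rfl⟩ := Fin.exists_castSucc_eq.2 (hj.trans (Fin.castSucc_lt_last i)).ne
      simp
    have hlast (x : ∀ i : Fin n, α i.castSucc) (b : α (Fin.last n)) :
        k (Fin.last n) (Fin.snoc x b) = k (Fin.last n) (Fin.snoc x b₀) := by
      refine hdep _ _ _ fun j hj => ?_
      obtain ⟨j, rfl⟩ := Fin.exists_castSucc_eq.2 hj.ne
      simp
    have key := ih (α := fun i => α i.castSucc) (fun i x => k i.castSucc (Fin.snoc x b₀))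
      (fun i x x' h => hdep _ _ _ fun j hj => by
        obtain ⟨j, rfl⟩ := Fin.exists_castSucc_eq.2 (hj.trans (Fin.castSucc_lt_last i)).ne
        simpa using h j (by simpa using hj))
      (fun i x => hsum _ _)
    rw [← (Fin.snocEquiv α).sum_comp, Fintype.sum_prod_type_right, ← key]
    refine Finset.sum_congr rfl fun x _ => ?_
    have hterm (b : α (Fin.last n)) :
        ∏ i, k i (Fin.snocEquiv α (b, x)) (Fin.snocEquiv α (b, x) i) =
          (∏ i : Fin n, k i.castSucc (Fin.snoc x b₀) (x i)) *
            k (Fin.last n) (Fin.snoc x b₀) b := by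
      change ∏ i, k i (Fin.snoc x b) ((Fin.snoc x b : ∀ i, α i) i) = _
      simp [Fin.prod_univ_castSucc, hcast, hlast]
    simp only [hterm, ← Finset.mul_sum, hsum, mul_one]

/-- Gibbs' inequality in the form needed for sub-probability weights. -/
lemma sum_mul_log_le_sum_mul_log {γ : Type} [Fintype γ] {p q : γ → ℝ} (hp : ∀ c, 0 < p c)
    (hq : ∀ c, 0 < q c) (h : ∑ c, q c ≤ ∑ c, p c) :
    ∑ c, p c * log (q c) ≤ ∑ c, p c * log (p c) := by
  have hterm (c : γ) : p c * log (q c) - p c * log (p c) ≤ q c - p c := by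
    have := mul_le_mul_of_nonneg_left (log_le_sub_one_of_pos (div_pos (hq c) (hp c))) (hp c).le
    rw [log_div (hq c).ne' (hp c).ne', mul_sub, mul_sub, mul_div_cancel₀ _ (hp c).ne'] at this
    linarith
  have := Finset.sum_le_sum fun c (_ : c ∈ Finset.univ) => hterm c
  simp only [Finset.sum_sub_distrib] at this
  linarith

lemma sum_margXY (P : Cfg α β → ℝ) (i : Fin d) (y : β) :
    ∑ a, margXY P i a y = margY P y := by
  simp only [margXY, margY]
  rw [Finset.sum_comm]
  simp

lemma sum_margXXY (P : Cfg α β → ℝ) (i j : Fin d) (a : α i) (y : β) :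
    ∑ b, margXXY P i j a b y = margXY P i a y := by
  simp only [margXXY, margXY]
  rw [Finset.sum_comm]
  simp [ite_and]

variable {P : Cfg α β → ℝ}

lemma margY_pos [∀ i, Nonempty (α i)] (hpos : ∀ z, 0 < P z) (y : β) : 0 < margY P y :=
  Finset.sum_pos (fun _ _ => hpos _) Finset.univ_nonempty

lemma margXY_pos (hpos : ∀ z, 0 < P z) (i : Fin d) (x : ∀ i, α i) (y : β) :
    0 < margXY P i (x i) y :=
  Finset.sum_pos' (fun w _ => by split_ifs; exacts [(hpos _).le, le_rfl])
    ⟨x, Finset.mem_univ _, by simpa using hpos (x, y)⟩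

lemma margXXY_pos (hpos : ∀ z, 0 < P z) (i j : Fin d) (x : ∀ i, α i) (y : β) :
    0 < margXXY P i j (x i) (x j) y :=
  Finset.sum_pos' (fun w _ => by split_ifs; exacts [(hpos _).le, le_rfl])
    ⟨x, Finset.mem_univ _, by simpa using hpos (x, y)⟩

/-- The conditional pmf of `X i` given its mother `X (μ i)` and `Y = y`; for `i = 0` the
conditional pmf of `X 0` given `Y = y`. -/
def motherKernel (P : Cfg α β → ℝ) (μ : Fin d → Fin d) (y : β) (i : Fin d) (x : ∀ j, α j)
    (b : α i) : ℝ :=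
  if (i : ℕ) = 0 then margXY P i b y / margY P y
  else margXXY P (μ i) i (x (μ i)) b y / margXY P (μ i) (x (μ i)) y

lemma motherKernel_pos [∀ i, Nonempty (α i)] (hpos : ∀ z, 0 < P z) (μ : Fin d → Fin d) (y : β)
    (i : Fin d) (x : ∀ j, α j) : 0 < motherKernel P μ y i x (x i) := by
  unfold motherKernel
  split_ifs
  · exact div_pos (margXY_pos hpos _ _ _) (margY_pos hpos _)
  · exact div_pos (margXXY_pos hpos _ _ _ _) (margXY_pos hpos _ _ _)

lemma sum_motherKernel [∀ i, Nonempty (α i)] (hpos : ∀ z, 0 < P z) (μ : Fin d → Fin d) (y : β)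
    (i : Fin d) (x : ∀ j, α j) : ∑ b, motherKernel P μ y i x b = 1 := by
  unfold motherKernel
  split_ifs
  · rw [← Finset.sum_div, sum_margXY, div_self (margY_pos hpos _).ne']
  · rw [← Finset.sum_div, sum_margXXY, div_self (margXY_pos hpos _ _ _).ne']

variable [Fintype β]

lemma margX_pos (hpos : ∀ z, 0 < P z) (i : Fin d) (z : Cfg α β) : 0 < margX P i (z.1 i) :=
  Finset.sum_pos' (fun w _ => by split_ifs; exacts [(hpos _).le, le_rfl])
    ⟨z, Finset.mem_univ _, by simpa using hpos z⟩

lemma sum_margY_mul (P : Cfg α β → ℝ) (f : β → ℝ) :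
    ∑ y, margY P y * f y = ∑ z, P z * f z.2 := by
  simp only [margY, Finset.sum_mul, Fintype.sum_prod_type_right]

lemma sum_margX_mul (P : Cfg α β → ℝ) (i : Fin d) (f : α i → ℝ) :
    ∑ a, margX P i a * f a = ∑ z, P z * f (z.1 i) := by
  simp only [margX, Finset.sum_mul]
  rw [Finset.sum_comm]
  simp [ite_mul]

lemma sum_margXY_mul (P : Cfg α β → ℝ) (i : Fin d) (f : α i → β → ℝ) :
    ∑ y, ∑ a, margXY P i a y * f a y = ∑ z, P z * f (z.1 i) z.2 := by
  simp only [margXY, Finset.sum_mul, Fintype.sum_prod_type_right]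
  refine Finset.sum_congr rfl fun y _ => ?_
  rw [Finset.sum_comm]
  simp [ite_mul]

lemma sum_margXXY_mul (P : Cfg α β → ℝ) (i j : Fin d) (f : α i → α j → β → ℝ) :
    ∑ y, ∑ a, ∑ b, margXXY P i j a b y * f a b y = ∑ z, P z * f (z.1 i) (z.1 j) z.2 := by
  simp only [margXXY, Finset.sum_mul, Fintype.sum_prod_type_right]
  refine Finset.sum_congr rfl fun y _ => ?_
  simp_rw [Finset.sum_comm (s := (Finset.univ : Finset (α j)))]
  rw [Finset.sum_comm]
  simp [ite_mul, ite_and]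

lemma sum_margY_mul_prod_motherKernel [∀ i, Nonempty (α i)] (hpos : ∀ z, 0 < P z)
    {μ : Fin d → Fin d} (hμ : ∀ i : Fin d, 0 < (i : ℕ) → μ i < i) :
    ∑ z : Cfg α β, margY P z.2 * ∏ i, motherKernel P μ z.2 i z.1 (z.1 i) = ∑ z, P z := by
  rw [Fintype.sum_prod_type_right, Fintype.sum_prod_type_right]
  refine Finset.sum_congr rfl fun y _ => ?_
  dsimp only
  rw [← Finset.mul_sum, sum_prod_kernel_eq_one, mul_one, margY]
  · intro i x x' h
    unfold motherKernel
    split_ifs with hi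
    · rfl
    · rw [h _ (hμ i (Nat.pos_of_ne_zero hi))]
  · exact sum_motherKernel hpos μ y

/-- Pointwise form of the weight of a Generalized Naive Bayes approximation. -/
lemma sum_log_margXXY_sub_sum_log_margXY [∀ i, Nonempty (α i)] (hd : 2 ≤ d)
    (hpos : ∀ z, 0 < P z) {μ : Fin d → Fin d} (hμ : ∀ i : Fin d, 0 < (i : ℕ) → μ i < i)
    (z : Cfg α β) :
    (∑ i ∈ Finset.univ.filter (fun i : Fin d => 1 ≤ (i : ℕ)),
        log (margXXY P (μ i) i (z.1 (μ i)) (z.1 i) z.2 /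
          (margY P z.2 * margX P (μ i) (z.1 (μ i)) * margX P i (z.1 i))))
      - (∑ i ∈ Finset.univ.filter (fun i : Fin d => 2 ≤ (i : ℕ)),
        log (margXY P (μ i) (z.1 (μ i)) z.2 / (margX P (μ i) (z.1 (μ i)) * margY P z.2))) =
    log (margY P z.2 * ∏ i, motherKernel P μ z.2 i z.1 (z.1 i))
      - (∑ i, log (margX P i (z.1 i))) - log (margY P z.2) := by
  obtain ⟨n, rfl⟩ := Nat.exists_eq_add_of_le' hd
  have hY := (margY_pos hpos z.2).ne'
  have hX i := (margX_pos hpos i z).ne'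
  have hXY i := (margXY_pos hpos i z.1 z.2).ne'
  have hXXY i j := (margXXY_pos hpos i j z.1 z.2).ne'
  have hμ1 : μ 1 = 0 := by
    simpa using hμ 1 (by simp)
  have hX1 : log (margX P (μ 1) (z.1 (μ 1))) = log (margX P 0 (z.1 0)) := by rw [hμ1]
  have hXY1 : log (margXY P (μ 1) (z.1 (μ 1)) z.2) = log (margXY P 0 (z.1 0) z.2) := by rw [hμ1]
  rw [log_mul hY (Finset.prod_ne_zero_iff.2 fun i _ => (motherKernel_pos hpos μ _ i _).ne'),
    log_prod fun i _ => (motherKernel_pos hpos μ _ i _).ne']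
  simp only [Finset.sum_filter, Fin.sum_univ_succ (n := n + 1), Fin.sum_univ_succ (n := n)]
  simp [motherKernel, log_div, log_mul, hY, hX, hXY, hXXY, Finset.sum_add_distrib,
    Finset.sum_sub_distrib]
  linear_combination hXY1 - hX1

end Marginals

end GNB

/-- The weight of any Generalized Naive Bayes approximation never exceeds
the total correlation of the joint distribution:
`Σ_{i=2}^d I(Y,X_{μ i},Xᵢ) − Σ_{i=3}^d I(Y,X_{μ i}) ≤ Σ_{i=1}^d H(Xᵢ) + H(Y) − H(X₁,…,X_d,Y)`
(`0`-based indices; `μ` is a mother function: `μ i < i` for all `i ≠ 0`). -/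
theorem gnb_weight_le_total_correlation (d : ℕ) (hd : 2 ≤ d) (α : Fin d → Type) (β : Type)
    [∀ i, Fintype (α i)] [∀ i, Nonempty (α i)] [Fintype β] [Nonempty β]
    (P : GNB.Cfg α β → ℝ) (hpos : ∀ z, 0 < P z) (hsum : ∑ z, P z = 1)
    (μ : Fin d → Fin d) (hμ : ∀ i : Fin d, 0 < (i : ℕ) → μ i < i) :
    (∑ i ∈ Finset.univ.filter (fun i : Fin d => 1 ≤ (i : ℕ)), GNB.IY3 P (μ i) i)
      - (∑ i ∈ Finset.univ.filter (fun i : Fin d => 2 ≤ (i : ℕ)), GNB.IY2 P (μ i)) ≤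
    (∑ i, GNB.HX P i) + GNB.HY P - GNB.HJoint P := by
  have hR (z : GNB.Cfg α β) : 0 < GNB.margY P z.2 * ∏ i, GNB.motherKernel P μ z.2 i z.1 (z.1 i) :=
    mul_pos (GNB.margY_pos hpos _)
      (Finset.prod_pos fun i _ => GNB.motherKernel_pos hpos μ z.2 i z.1)
  have hgibbs := GNB.sum_mul_log_le_sum_mul_log hpos hR
    (GNB.sum_margY_mul_prod_motherKernel hpos hμ).le
  have hweight :
      (∑ i ∈ Finset.univ.filter (fun i : Fin d => 1 ≤ (i : ℕ)), GNB.IY3 P (μ i) i)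
        - (∑ i ∈ Finset.univ.filter (fun i : Fin d => 2 ≤ (i : ℕ)), GNB.IY2 P (μ i)) =
      ∑ z : GNB.Cfg α β, P z * (log (GNB.margY P z.2 * ∏ i, GNB.motherKernel P μ z.2 i z.1 (z.1 i))
        - (∑ i, log (GNB.margX P i (z.1 i))) - log (GNB.margY P z.2)) := by
    simp only [GNB.IY3, GNB.IY2, ← GNB.sum_log_margXXY_sub_sum_log_margXY hd hpos hμ]
    simp only [GNB.sum_margXXY_mul P _ _ fun a b y =>
        log (GNB.margXXY P _ _ a b y / (GNB.margY P y * GNB.margX P _ a * GNB.margX P _ b)),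
      GNB.sum_margXY_mul P _ fun a y =>
        log (GNB.margXY P _ a y / (GNB.margX P _ a * GNB.margY P y)),
      mul_sub, Finset.mul_sum, Finset.sum_sub_distrib]
    rw [Finset.sum_comm, Finset.sum_comm (t := Finset.univ.filter (fun i : Fin d => 2 ≤ (i : ℕ)))]
  have hHX : ∑ i, GNB.HX P i = -∑ z, P z * ∑ i, log (GNB.margX P i (z.1 i)) := by
    simp only [GNB.HX, GNB.sum_margX_mul P _ fun a => log (GNB.margX P _ a), Finset.mul_sum,
      Finset.sum_neg_distrib]
    rw [Finset.sum_comm]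
  have hHY : GNB.HY P = -∑ z, P z * log (GNB.margY P z.2) := by
    rw [GNB.HY, GNB.sum_margY_mul P fun y => log (GNB.margY P y)]
  rw [hweight, hHX, hHY, GNB.HJoint]
  simp only [mul_sub, Finset.sum_sub_distrib]
  linarith
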